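/- Let X be a compact metric space with metric d, and μ, ν Borel probability measures on X. Then the Kantorovich duality holds: inf over couplings ρ of μ and ν of ∫ d dρ equals sup over 1-Lipschitz f : X → ℝ of |∫ f dμ − ∫ f dν|. -/

import Mathlib

open MeasureTheory
open scoped CompactlySupported

noncomputable section

lemma kd_cont_integrable {Y : Type*} [TopologicalSpace Y] [CompactSpace Y]
    [MeasurableSpace Y] [BorelSpace Y] (μ : Measure Y) [IsFiniteMeasure μ]
    (f : Y → ℝ) (hf : Continuous f) : Integrable f μ :=
  hf.integrable_of_hasCompactSupport (HasCompactSupport.of_compactSpace f)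

/-- The key inequality: the inf-convolution argument. -/
lemma kd_key {X : Type*} [MetricSpace X] [CompactSpace X] [MeasurableSpace X] [BorelSpace X]
    (μ ν : Measure X) [IsProbabilityMeasure μ] [IsProbabilityMeasure ν] (S : ℝ)
    (hS : ∀ f : X → ℝ, LipschitzWith 1 f → ∫ z, f z ∂μ - ∫ z, f z ∂ν ≤ S)
    (φ ψ : C(X, ℝ)) (c : ℝ) (hc : 0 ≤ c)
    (h : ∀ x y, 0 ≤ φ x + ψ y + c * dist x y) :
    0 ≤ ∫ z, φ z ∂μ + ∫ z, ψ z ∂ν + c * S := by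
  have : Nonempty X := nonempty_of_isProbabilityMeasure μ
  let f : X → ℝ := fun x => ⨅ y, (ψ y + c * dist x y)
  have hb : ∀ x, BddBelow (Set.range fun y => ψ y + c * dist x y) := by
    intro x
    refine ⟨-φ x, ?_⟩
    rintro _ ⟨y, rfl⟩
    have := h x y
    simp only
    linarith
  have hfψ : ∀ x, f x ≤ ψ x := fun x => (ciInf_le (hb x) x).trans (by simp)
  have hfφ : ∀ x, -φ x ≤ f x := fun x => le_ciInf fun y => by linarith [h x y]
  have hflip : ∀ x x', f x ≤ f x' + c * dist x x' := by
    intro x x'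
    rw [← sub_le_iff_le_add]
    refine le_ciInf fun y => ?_
    have h1 : f x ≤ ψ y + c * dist x y := ciInf_le (hb x) y
    have h2 := mul_le_mul_of_nonneg_left (dist_triangle x x' y) hc
    linarith
  have hL : LipschitzWith (Real.toNNReal c) f := LipschitzWith.of_le_add_mul _ (by
    intro x y
    rw [Real.coe_toNNReal c hc]
    exact hflip x y)
  have hfc := hL.continuous
  have h1 : ∫ z, f z ∂ν ≤ ∫ z, ψ z ∂ν :=
    integral_mono (kd_cont_integrable ν f hfc) (kd_cont_integrable ν ψ ψ.continuous) hfψ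
  have h2 : ∫ z, -φ z ∂μ ≤ ∫ z, f z ∂μ :=
    integral_mono (kd_cont_integrable μ _ φ.continuous.neg) (kd_cont_integrable μ f hfc) hfφ
  rw [integral_neg] at h2
  have h3 : ∫ z, f z ∂μ - ∫ z, f z ∂ν ≤ c * S := by
    rcases hc.eq_or_lt with rfl | hc
    · obtain ⟨a⟩ := this
      have : ∀ x, f x = f a := fun x => le_antisymm (by simpa using hflip x a)
        (by simpa using hflip a x)
      simp [this]
    · have hl : LipschitzWith 1 (fun x => c⁻¹ * f x) := LipschitzWith.of_le_add (by
        intro x y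
        have := hflip x y
        calc c⁻¹ * f x ≤ c⁻¹ * (f y + c * dist x y) := by gcongr
          _ = _ := by field_simp)
      have := hS _ hl
      rw [integral_const_mul, integral_const_mul, ← mul_sub, inv_mul_le_iff₀ hc] at this
      exact this
  linarith

/-- The positive functional on `C(X × X)`. -/
lemma kd_functional {X : Type*} [MetricSpace X] [CompactSpace X] [MeasurableSpace X]
    [BorelSpace X]
    (μ ν : Measure X) [IsProbabilityMeasure μ] [IsProbabilityMeasure ν] (S : ℝ)
    (hS : ∀ f : X → ℝ, LipschitzWith 1 f → ∫ z, f z ∂μ - ∫ z, f z ∂ν ≤ S) :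
    ∃ G : C(X × X, ℝ) →ₗ[ℝ] ℝ, (∀ h, (∀ p, 0 ≤ h p) → 0 ≤ G h) ∧
      (∀ h : C(X × X, ℝ), ∀ φ : C(X, ℝ), (∀ p, h p = φ p.1) → G h = ∫ z, φ z ∂μ) ∧
      (∀ h : C(X × X, ℝ), ∀ φ : C(X, ℝ), (∀ p, h p = φ p.2) → G h = ∫ z, φ z ∂ν) ∧
      (∀ h : C(X × X, ℝ), (∀ p, h p = dist p.1 p.2) → G h ≤ S) := by
  let L : (C(X, ℝ) × C(X, ℝ) × ℝ) →ₗ[ℝ] ℝ :=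
    { toFun := fun w => ∫ z, w.1 z ∂μ + ∫ z, w.2.1 z ∂ν + w.2.2 * S
      map_add' := by
        intro a b
        simp only [Prod.fst_add, Prod.snd_add, ContinuousMap.add_apply]
        rw [integral_add (kd_cont_integrable μ _ a.1.continuous)
          (kd_cont_integrable μ _ b.1.continuous),
          integral_add (kd_cont_integrable ν _ a.2.1.continuous)
          (kd_cont_integrable ν _ b.2.1.continuous)]
        ring
      map_smul' := by
        intro r a
        simp only [Prod.smul_fst, Prod.smul_snd, ContinuousMap.smul_apply, smul_eq_mul,
          integral_const_mul, RingHom.id_apply]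
        ring }
  have hLdef : ∀ φ ψ c, L (φ, ψ, c) = ∫ z, φ z ∂μ + ∫ z, ψ z ∂ν + c * S := fun _ _ _ => rfl
  let s : PointedCone ℝ (C(X × X, ℝ) × (C(X, ℝ) × C(X, ℝ) × ℝ)) :=
    { carrier := {e | 0 ≤ e.2.2.2 ∧
        ∀ p : X × X, 0 ≤ e.1 p + e.2.1 p.1 + e.2.2.1 p.2 + e.2.2.2 * dist p.1 p.2}
      add_mem' := by
        rintro a b ⟨ha, ha'⟩ ⟨hb, hb'⟩
        refine ⟨add_nonneg ha hb, fun p => ?_⟩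
        have h1 := ha' p
        have h2 := hb' p
        simp only [Prod.fst_add, Prod.snd_add, ContinuousMap.add_apply]
        linarith
      zero_mem' := by
        refine ⟨le_rfl, fun p => ?_⟩
        simp
      smul_mem' := by
        rintro ⟨r, hr⟩ a ⟨ha, ha'⟩
        refine ⟨mul_nonneg hr ha, fun p => ?_⟩
        have h1 := mul_nonneg hr (ha' p)
        have h2 : (⟨r, hr⟩ : {r : ℝ // 0 ≤ r}) • a = r • a := rfl
        rw [h2]
        simp only [Prod.smul_fst, Prod.smul_snd, ContinuousMap.smul_apply, smul_eq_mul]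
        linarith }
  have hs : ∀ h φ ψ c, ((h, φ, ψ, c) : (C(X × X, ℝ) × (C(X, ℝ) × C(X, ℝ) × ℝ))) ∈ s ↔ (0 ≤ c ∧
        ∀ p : X × X, 0 ≤ h p + φ p.1 + ψ p.2 + c * dist p.1 p.2) := fun _ _ _ _ => Iff.rfl
  let F : (C(X × X, ℝ) × (C(X, ℝ) × C(X, ℝ) × ℝ)) →ₗ.[ℝ] ℝ :=
    { domain := LinearMap.ker (LinearMap.fst ℝ C(X × X, ℝ) (C(X, ℝ) × C(X, ℝ) × ℝ))
      toFun := (L.comp (LinearMap.snd ℝ C(X × X, ℝ) (C(X, ℝ) × C(X, ℝ) × ℝ))).comp (Submodule.subtype _) }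
  have hdom : ∀ w : (C(X, ℝ) × C(X, ℝ) × ℝ), ((0, w) : (C(X × X, ℝ) × (C(X, ℝ) × C(X, ℝ) × ℝ))) ∈ F.domain := fun w => by
    change (0, w) ∈ LinearMap.ker _
    simp
  obtain ⟨g, hg, hgs⟩ := riesz_extension s F (by
      rintro ⟨⟨h, φ, ψ, c⟩, hx⟩ hxs
      have hx : h = 0 := hx
      subst hx
      rw [hs] at hxs
      change 0 ≤ L (φ, ψ, c)
      refine kd_key μ ν S hS φ ψ c hxs.1 fun x y => ?_
      have := hxs.2 (x, y)
      simpa using this) (by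
      rintro ⟨h, φ, ψ, c⟩
      refine ⟨⟨(0, ContinuousMap.const X ‖h‖ - φ, -ψ, -c), hdom _⟩, ?_⟩
      refine ⟨?_, fun p => ?_⟩
      · simp
      · have := (abs_le.1 (h.norm_coe_le_norm p)).1
        simp
        linarith)
  have hgL : ∀ w, g (0, w) = L w := fun w => hg ⟨(0, w), hdom w⟩
  have hsplit : ∀ h w, g (h, w) = g (h, 0) + L w := fun h w => by
    rw [← hgL, ← map_add]; simp
  have hpos : ∀ (h : C(X × X, ℝ)) (φ ψ : C(X, ℝ)) (c : ℝ), 0 ≤ c → (∀ p : X × X, 0 ≤ h p + φ p.1 + ψ p.2 + c * dist p.1 p.2) →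
      0 ≤ g (h, 0) + (∫ z, φ z ∂μ + ∫ z, ψ z ∂ν + c * S) := by
    intro h φ ψ c hc hh
    rw [← hLdef, ← hsplit]
    exact hgs _ ((hs _ _ _ _).2 ⟨hc, hh⟩)
  have hneg : ∀ h, g (-h, 0) = - g (h, 0) := fun h => by
    rw [← map_neg]; simp
  refine ⟨g.comp (LinearMap.inl ℝ _ _), ?_, ?_, ?_, ?_⟩
  · intro h hh
    simpa using hpos h 0 0 0 le_rfl (by simpa using hh)
  · intro h φ hh
    have h1 := hpos h (-φ) 0 0 le_rfl (by intro p; simp [hh])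
    have h2 := hpos (-h) φ 0 0 le_rfl (by intro p; simp [hh])
    rw [hneg] at h2
    simp [integral_neg] at h1 h2
    simp
    linarith
  · intro h φ hh
    have h1 := hpos h 0 (-φ) 0 le_rfl (by intro p; simp [hh])
    have h2 := hpos (-h) 0 φ 0 le_rfl (by intro p; simp [hh])
    rw [hneg] at h2
    simp [integral_neg] at h1 h2
    simp
    linarith
  · intro h hh
    have h2 := hpos (-h) 0 0 1 zero_le_one (by intro p; simp [hh])
    rw [hneg] at h2
    simp at h2
    simpa using h2

/-- Riesz representation on a compact metric space. -/
lemma kd_riesz {Y : Type*} [TopologicalSpace Y] [T2Space Y] [CompactSpace Y]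
    [MeasurableSpace Y] [BorelSpace Y]
    (G : C(Y, ℝ) →ₗ[ℝ] ℝ) (hG : ∀ h, (∀ p, 0 ≤ h p) → 0 ≤ G h) :
    ∃ ρ : Measure Y, IsFiniteMeasure ρ ∧ ∀ h : C(Y, ℝ), ∫ y, h y ∂ρ = G h := by
  let Λ₀ : C_c(Y, ℝ) →ₗ[ℝ] ℝ :=
    { toFun := fun f => G f.toContinuousMap
      map_add' := fun a b => by rw [← map_add]; rfl
      map_smul' := fun r a => by
        rw [RingHom.id_apply, ← map_smul]; rfl }
  let Λ : C_c(Y, ℝ) →ₚ[ℝ] ℝ := PositiveLinearMap.mk₀ Λ₀ fun f hf => hG _ fun p => hf p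
  have : IsFiniteMeasureOnCompacts (RealRMK.rieszMeasure Λ) := inferInstance
  refine ⟨RealRMK.rieszMeasure Λ, ⟨isCompact_univ.measure_lt_top⟩, fun h => ?_⟩
  have := RealRMK.integral_rieszMeasure Λ (CompactlySupportedContinuousMap.continuousMapEquiv h)
  exact this

/-- Easy direction. -/
lemma kd_easy {X : Type*} [MetricSpace X] [CompactSpace X] [MeasurableSpace X] [BorelSpace X]
    (μ ν : Measure X) (ρ : Measure (X × X)) [IsProbabilityMeasure ρ]
    (h1 : ρ.map Prod.fst = μ) (h2 : ρ.map Prod.snd = ν) (f : X → ℝ) (hf : LipschitzWith 1 f) :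
    |∫ z, f z ∂μ - ∫ z, f z ∂ν| ≤ ∫ p, dist p.1 p.2 ∂ρ := by
  have hfc := hf.continuous
  rw [← h1, ← h2, integral_map measurable_fst.aemeasurable hfc.aestronglyMeasurable,
    integral_map measurable_snd.aemeasurable hfc.aestronglyMeasurable,
    ← integral_sub (kd_cont_integrable ρ (fun p => f p.1) (by fun_prop))
      (kd_cont_integrable ρ (fun p => f p.2) (by fun_prop))]
  refine abs_integral_le_integral_abs.trans (integral_mono
    (kd_cont_integrable ρ _ (by fun_prop)) (kd_cont_integrable ρ _ (by fun_prop)) fun p => ?_)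
  have := hf.dist_le_mul p.1 p.2
  simpa [Real.dist_eq] using this

/-- Kantorovich duality on a compact metric space: the minimal transport cost
`inf_ρ ∫ d dρ` over couplings `ρ` of `μ` and `ν` equals
`sup_f |∫ f dμ - ∫ f dν|` over `1`-Lipschitz `f`. -/
theorem stmt18 (X : Type*) [MetricSpace X] [CompactSpace X]
    [MeasurableSpace X] [BorelSpace X]
    (μ ν : Measure X) (hμ : IsProbabilityMeasure μ) (hν : IsProbabilityMeasure ν) :
    sInf {r : ℝ | ∃ ρ : Measure (X × X), IsProbabilityMeasure ρ ∧
        ρ.map Prod.fst = μ ∧ ρ.map Prod.snd = ν ∧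
        r = ∫ p, dist p.1 p.2 ∂ρ} =
      sSup {r : ℝ | ∃ f : X → ℝ, LipschitzWith 1 f ∧
        r = |∫ z, f z ∂μ - ∫ z, f z ∂ν|} := by
  apply le_antisymm
  · set S := sSup {r : ℝ | ∃ f : X → ℝ, LipschitzWith 1 f ∧
        r = |∫ z, f z ∂μ - ∫ z, f z ∂ν|} with hSdef
    have hS : ∀ f : X → ℝ, LipschitzWith 1 f → ∫ z, f z ∂μ - ∫ z, f z ∂ν ≤ S := by
      intro f hf
      refine (le_abs_self _).trans (le_csSup ⟨∫ p, dist p.1 p.2 ∂(μ.prod ν), ?_⟩ ⟨f, hf, rfl⟩)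
      rintro _ ⟨f, hf, rfl⟩
      exact kd_easy μ ν (μ.prod ν) (by simp) (by simp) f hf
    obtain ⟨G, hG, hG1, hG2, hGd⟩ := kd_functional μ ν S hS
    obtain ⟨ρ, hρ, hρG⟩ := kd_riesz G hG
    have hprob : IsProbabilityMeasure ρ := by
      have := hρG (ContinuousMap.const _ 1)
      rw [hG1 _ (ContinuousMap.const _ 1) (fun _ => rfl)] at this
      simp at this
      exact ⟨by rwa [measureReal_def, ENNReal.toReal_eq_one_iff] at this⟩
    have e1 : ρ.map Prod.fst = μ := by
      apply ext_of_forall_integral_eq_of_IsFiniteMeasure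
      intro f
      rw [integral_map measurable_fst.aemeasurable f.continuous.aestronglyMeasurable]
      exact (hρG ⟨fun p => f p.1, by fun_prop⟩).trans (hG1 _ f.toContinuousMap fun _ => rfl)
    have e2 : ρ.map Prod.snd = ν := by
      apply ext_of_forall_integral_eq_of_IsFiniteMeasure
      intro f
      rw [integral_map measurable_snd.aemeasurable f.continuous.aestronglyMeasurable]
      exact (hρG ⟨fun p => f p.2, by fun_prop⟩).trans (hG2 _ f.toContinuousMap fun _ => rfl)
    have ed : ∫ p, dist p.1 p.2 ∂ρ ≤ S :=
      (hρG ⟨fun p => dist p.1 p.2, by fun_prop⟩).trans_le (hGd _ fun _ => rfl)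
    refine le_trans (csInf_le ⟨0, ?_⟩ ⟨ρ, hprob, e1, e2, rfl⟩) ed
    rintro _ ⟨ρ, _, _, _, rfl⟩
    exact integral_nonneg fun _ => dist_nonneg
  · apply csSup_le
    · exact ⟨|∫ z : X, (0:ℝ) ∂μ - ∫ z : X, (0:ℝ) ∂ν|, fun _ => 0,
        LipschitzWith.of_dist_le_mul (by simp), rfl⟩
    rintro _ ⟨f, hf, rfl⟩
    apply le_csInf
    · exact ⟨_, μ.prod ν, inferInstance, by simp, by simp, rfl⟩
    rintro _ ⟨ρ, _, h1, h2, rfl⟩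
    exact kd_easy μ ν ρ h1 h2 f hf
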